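/- The group G₂ acts transitively on the unit sphere S⁶ of Im 𝕆, and the isotropy group of a point is isomorphic to SU(3); hence S⁶ ≅ G₂/SU(3). -/

import Mathlib

/-!
STATEMENT 15. The group `G₂` acts transitively on the unit sphere `S⁶` of `Im 𝕆`, and
the isotropy group of a point is isomorphic to `SU(3)`; hence `S⁶ ≅ G₂/SU(3)`.

The octonions are constructed from the quaternions by the Cayley–Dickson construction,
`G₂` is the group of `ℝ`-algebra automorphisms of `𝕆`, `Im 𝕆` is the purely imaginary
part with the inner product `⟨x,y⟩ = Re (x ȳ)`, and `S⁶` is the sphere of unit imaginary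
octonions, on which `G₂` acts by restriction of its action on `Im 𝕆`.
-/

noncomputable section

/-- The octonions, obtained from the quaternions by the Cayley–Dickson construction:
`𝕆 = ℍ ⊕ ℍl`, represented as pairs of quaternions. -/
def Octonion : Type := Quaternion ℝ × Quaternion ℝ

namespace Octonion

instance : AddCommGroup Octonion :=
  inferInstanceAs (AddCommGroup (Quaternion ℝ × Quaternion ℝ))

instance : Module ℝ Octonion :=
  inferInstanceAs (Module ℝ (Quaternion ℝ × Quaternion ℝ))

instance : One Octonion := ⟨((1 : Quaternion ℝ), (0 : Quaternion ℝ))⟩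

/-- Cayley–Dickson multiplication: `(a,b)(c,d) = (ac − d b̄, ā d + c b)`. -/
instance : Mul Octonion :=
  ⟨fun x y => (x.1 * y.1 - y.2 * star x.2, star x.1 * y.2 + y.1 * x.2)⟩

/-- Octonion conjugation: `(a,b)* = (ā, −b)`. -/
instance : Star Octonion := ⟨fun x => (star x.1, -x.2)⟩

/-- The real part of an octonion. -/
def re (x : Octonion) : ℝ := x.1.re

/-- The purely imaginary part `Im 𝕆 ≅ ℝ⁷` of the octonions. -/
def ImO : Submodule ℝ Octonion where
  carrier := {x | re x = 0}
  add_mem' := by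
    intro a b ha hb
    show ((a + b : Octonion).1).re = 0
    have : (a + b : Octonion).1 = a.1 + b.1 := rfl
    rw [this]
    rw [Quaternion.re_add]
    rw [show a.1.re = 0 from ha, show b.1.re = 0 from hb, add_zero]
  zero_mem' := by
    show ((0 : Octonion).1).re = 0
    simp [show (0 : Octonion).1 = 0 from rfl, Quaternion.re_zero]
  smul_mem' := by
    intro c x hx
    show ((c • x : Octonion).1).re = 0
    have h1 : (c • x : Octonion).1 = c • x.1 := rfl
    have hx' : (x.1).re = 0 := hx
    rw [h1]
    simp [Quaternion.re_smul, hx']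

/-- The inner product of `𝕆`: `⟨x, y⟩ = Re (x ȳ)`. -/
def oinner (x y : Octonion) : ℝ := re (x * star y)

end Octonion

/-- `G₂`, the group of all `ℝ`-algebra automorphisms of the octonions, realized as the
subgroup of `ℝ`-linear automorphisms of `𝕆` preserving the octonion multiplication. -/
def G2 : Subgroup (Octonion ≃ₗ[ℝ] Octonion) where
  carrier := {g | ∀ x y : Octonion, g (x * y) = g x * g y}
  one_mem' := fun _ _ => rfl
  mul_mem' := by
    intro f g hf hg x y
    show f (g (x * y)) = f (g x) * f (g y)
    rw [hg, hf]
  inv_mem' := by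
    intro f hf x y
    apply f.injective
    show f (f.symm (x * y)) = f (f.symm x * f.symm y)
    rw [hf, f.apply_symm_apply, f.apply_symm_apply, f.apply_symm_apply]

/-- The unit sphere `S⁶` of `Im 𝕆`: the unit imaginary octonions. -/
def S6 : Set Octonion := {v | v ∈ Octonion.ImO ∧ Octonion.oinner v v = 1}

/-- The isotropy group (stabilizer) in `G₂` of a point `l`. -/
def isotropy (l : Octonion) : Subgroup G2 where
  carrier := {g | ((g : Octonion ≃ₗ[ℝ] Octonion)) l = l}
  one_mem' := rfl
  mul_mem' := by
    intro a b ha hb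
    show ((a : Octonion ≃ₗ[ℝ] Octonion)) (((b : Octonion ≃ₗ[ℝ] Octonion)) l) = l
    rw [show ((b : Octonion ≃ₗ[ℝ] Octonion)) l = l from hb,
      show ((a : Octonion ≃ₗ[ℝ] Octonion)) l = l from ha]
  inv_mem' := by
    intro a ha
    show ((a : Octonion ≃ₗ[ℝ] Octonion)).symm l = l
    rw [LinearEquiv.symm_apply_eq]
    exact (show ((a : Octonion ≃ₗ[ℝ] Octonion)) l = l from ha).symm

namespace Octonion

/-- First complex coordinate of an octonion (component along `1, i`). -/
def cz (x : Octonion) : ℂ := ⟨x.1.re, x.1.imI⟩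

/-- The remaining three complex coordinates of an octonion. -/
def cv (x : Octonion) : Fin 3 → ℂ :=
  ![⟨x.1.imJ, x.1.imK⟩, ⟨x.2.imJ, -x.2.imK⟩, ⟨x.2.re, -x.2.imI⟩]

/-- The octonion with prescribed complex coordinates. -/
def mk (a : ℂ) (u : Fin 3 → ℂ) : Octonion :=
  ((⟨a.re, a.im, (u 0).re, (u 0).im⟩ : Quaternion ℝ),
   (⟨(u 2).re, -(u 2).im, (u 1).re, -(u 1).im⟩ : Quaternion ℝ))

theorem cz_mk (a : ℂ) (u : Fin 3 → ℂ) : cz (mk a u) = a := rfl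

theorem cv_mk (a : ℂ) (u : Fin 3 → ℂ) : cv (mk a u) = u := by
  funext i
  fin_cases i <;> apply Complex.ext <;> simp [cv, mk]

theorem mk_eta (x : Octonion) : mk (cz x) (cv x) = x := by
  apply Prod.ext <;> apply Quaternion.ext <;> simp [cv, cz, mk]

theorem cext {x y : Octonion} (h : cz x = cz y) (h' : cv x = cv y) : x = y := by
  rw [← mk_eta x, ← mk_eta y, h, h']

theorem add_fst (x y : Octonion) : (x + y).1 = x.1 + y.1 := rfl
theorem add_snd (x y : Octonion) : (x + y).2 = x.2 + y.2 := rfl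
theorem neg_fst (x : Octonion) : (-x).1 = -x.1 := rfl
theorem neg_snd (x : Octonion) : (-x).2 = -x.2 := rfl
theorem smul_fst (r : ℝ) (x : Octonion) : (r • x).1 = r • x.1 := rfl
theorem smul_snd (r : ℝ) (x : Octonion) : (r • x).2 = r • x.2 := rfl
theorem one_fst : (1 : Octonion).1 = 1 := rfl
theorem one_snd : (1 : Octonion).2 = 0 := rfl
theorem one_fst_re : (1 : Octonion).1.re = 1 := rfl
theorem one_fst_imI : (1 : Octonion).1.imI = 0 := rfl
theorem one_fst_imJ : (1 : Octonion).1.imJ = 0 := rfl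
theorem one_fst_imK : (1 : Octonion).1.imK = 0 := rfl
theorem one_snd_re : (1 : Octonion).2.re = 0 := rfl
theorem one_snd_imI : (1 : Octonion).2.imI = 0 := rfl
theorem one_snd_imJ : (1 : Octonion).2.imJ = 0 := rfl
theorem one_snd_imK : (1 : Octonion).2.imK = 0 := rfl
theorem mul_fst (x y : Octonion) : (x * y).1 = x.1 * y.1 - y.2 * star x.2 := rfl
theorem mul_snd (x y : Octonion) : (x * y).2 = star x.1 * y.2 + y.1 * x.2 := rfl

theorem cz_add (x y : Octonion) : cz (x + y) = cz x + cz y := by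
  apply Complex.ext <;> simp [cz, add_fst]

theorem cv_add (x y : Octonion) : cv (x + y) = cv x + cv y := by
  funext i
  fin_cases i <;> apply Complex.ext <;> simp [cv, add_fst, add_snd] <;> ring

theorem cz_smul (r : ℝ) (x : Octonion) : cz (r • x) = r • cz x := by
  apply Complex.ext <;> simp [cz, smul_fst]

theorem cv_smul (r : ℝ) (x : Octonion) : cv (r • x) = r • cv x := by
  funext i
  fin_cases i <;> apply Complex.ext <;> simp [cv, smul_fst, smul_snd]

theorem cz_mul (x y : Octonion) : cz (x * y) = cz x * cz y - cv x ⬝ᵥ star (cv y) := by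
  apply Complex.ext <;> simp [cz, cv, mul_fst, dotProduct, Fin.sum_univ_three] <;> ring

theorem cv_mul (x y : Octonion) :
    cv (x * y) = cz x • cv y + star (cz y) • cv x + star (crossProduct (cv x) (cv y)) := by
  rw [cross_apply]
  funext i
  fin_cases i <;> apply Complex.ext <;> simp [cz, cv, mul_fst, mul_snd] <;> ring

/-- The base point `i`. -/
def l0 : Octonion := mk Complex.I 0

theorem mul_one' (x : Octonion) : x * 1 = x := by
  apply Prod.ext
  · rw [mul_fst, one_fst, one_snd]; simp
  · rw [mul_snd, one_fst, one_snd]; simp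

theorem one_mul' (x : Octonion) : 1 * x = x := by
  apply Prod.ext
  · rw [mul_fst, one_fst, one_snd]; simp
  · rw [mul_snd, one_fst, one_snd]; simp

theorem one_eq : (1 : Octonion) = mk 1 0 := by
  apply Prod.ext <;> apply Quaternion.ext <;> simp [mk, one_fst_re, one_fst_imI, one_fst_imJ, one_fst_imK, one_snd_re, one_snd_imI, one_snd_imJ, one_snd_imK]

theorem mem_S6_iff (x : Octonion) : x ∈ S6 ↔ x * x = -1 := by
  have key : x ∈ S6 ↔ x.1.re = 0 ∧ x.1.imI ^ 2 + x.1.imJ ^ 2 + x.1.imK ^ 2 +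
      (x.2.re ^ 2 + x.2.imI ^ 2 + x.2.imJ ^ 2 + x.2.imK ^ 2) = 1 := by
    show (x.1.re = 0 ∧ (x.1 * star x.1 - (-x.2) * star x.2).re = 1) ↔ _
    refine and_congr_right fun h => ?_
    simp [h]
    constructor <;> intro h <;> linarith
  rw [key]
  constructor
  · rintro ⟨h0, h1⟩
    apply Prod.ext <;> apply Quaternion.ext <;>
      simp [mul_fst, mul_snd, neg_fst, neg_snd,
        one_fst_re, one_fst_imI, one_fst_imJ, one_fst_imK, one_snd_re, one_snd_imI, one_snd_imJ, one_snd_imK, h0] <;> linarith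
  · intro h
    have h1 := congrArg Prod.fst h
    have h2 := congrArg Prod.snd h
    rw [mul_fst, neg_fst] at h1
    rw [mul_snd, neg_snd] at h2
    have a0 := congrArg QuaternionAlgebra.re h1
    have a1 := congrArg QuaternionAlgebra.imI h1
    have a2 := congrArg QuaternionAlgebra.imJ h1
    have a3 := congrArg QuaternionAlgebra.imK h1
    have b0 := congrArg QuaternionAlgebra.re h2
    have b1 := congrArg QuaternionAlgebra.imI h2
    have b2 := congrArg QuaternionAlgebra.imJ h2
    have b3 := congrArg QuaternionAlgebra.imK h2
    simp [one_fst_re, one_fst_imI, one_fst_imJ, one_fst_imK, one_snd_re, one_snd_imI, one_snd_imJ, one_snd_imK] at a0 a1 a2 a3 b0 b1 b2 b3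
    have h0 : x.1.re = 0 := by
      by_contra hne
      have c1 : x.1.imI = 0 := by apply mul_left_cancel₀ hne; linarith
      have c2 : x.1.imJ = 0 := by apply mul_left_cancel₀ hne; linarith
      have c3 : x.1.imK = 0 := by apply mul_left_cancel₀ hne; linarith
      have d0 : x.2.re = 0 := b0.resolve_left hne
      have d1 : x.2.imI = 0 := by apply mul_left_cancel₀ hne; linarith
      have d2 : x.2.imJ = 0 := by apply mul_left_cancel₀ hne; linarith
      have d3 : x.2.imK = 0 := by apply mul_left_cancel₀ hne; linarith
      rw [c1, c2, c3, d0, d1, d2, d3] at a0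
      nlinarith [mul_self_nonneg x.1.re]
    refine ⟨h0, ?_⟩
    rw [h0] at a0
    linarith

theorem G2_one {g : Octonion ≃ₗ[ℝ] Octonion} (hg : g ∈ G2) : g 1 = 1 := by
  have h := hg 1 (g.symm 1)
  rw [one_mul', g.apply_symm_apply, mul_one'] at h
  exact h.symm

theorem G2_S6 {g : Octonion ≃ₗ[ℝ] Octonion} (hg : g ∈ G2) {x : Octonion} (hx : x ∈ S6) :
    g x ∈ S6 := by
  rw [mem_S6_iff] at *
  rw [← hg, hx, map_neg, G2_one hg]

theorem mk_mul (a b : ℂ) (u v : Fin 3 → ℂ) : mk a u * mk b v =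
    mk (a * b - u ⬝ᵥ star v) (a • v + star b • u + star (crossProduct u v)) := by
  apply cext
  · rw [cz_mul]; simp only [cz_mk, cv_mk]
  · rw [cv_mul]; simp only [cz_mk, cv_mk]

theorem mk_add (a b : ℂ) (u v : Fin 3 → ℂ) : mk a u + mk b v = mk (a + b) (u + v) := by
  apply cext
  · rw [cz_add]; simp only [cz_mk]
  · rw [cv_add]; simp only [cv_mk]

theorem cz_zero : cz 0 = 0 := rfl

theorem cv_zero : cv 0 = 0 := by
  have h := cv_smul 0 0
  rwa [smul_zero, zero_smul] at h

theorem l0_mem : l0 ∈ S6 := by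
  have h : (-1 : Octonion) = (-1 : ℝ) • (1 : Octonion) := by rw [neg_smul, one_smul]
  rw [mem_S6_iff, l0, mk_mul, h, one_eq]
  apply cext
  · rw [cz_smul, cz_mk, cz_mk]; simp
  · rw [cv_smul, cv_mk, cv_mk]; simp

/-! ### `SU(3)` and the isotropy group of the base point -/

theorem su_cofactor {A : Matrix (Fin 3) (Fin 3) ℂ} (hA : A ∈ Matrix.specialUnitaryGroup (Fin 3) ℂ) :
    star A = A.adjugate := by
  rw [Matrix.mem_specialUnitaryGroup_iff] at hA
  have h1 : star A * A = 1 := Matrix.mem_unitaryGroup_iff'.1 hA.1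
  have h2 : A * A.adjugate = 1 := by rw [Matrix.mul_adjugate, hA.2, one_smul]
  exact left_inv_eq_right_inv h1 h2

theorem su_cross {A : Matrix (Fin 3) (Fin 3) ℂ} (hA : A ∈ Matrix.specialUnitaryGroup (Fin 3) ℂ)
    (u v : Fin 3 → ℂ) : A.mulVec (star (crossProduct u v)) =
      star (crossProduct (A.mulVec u) (A.mulVec v)) := by
  have h := su_cofactor hA
  rw [Matrix.adjugate_fin_three] at h
  have h' : A = star (star A) := (star_star A).symm
  rw [h] at h'
  have e : ∀ i j, A i j = _ := fun i j => congrFun (congrFun h' i) j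
  have e00 := e 0 0
  have e01 := e 0 1
  have e02 := e 0 2
  have e10 := e 1 0
  have e11 := e 1 1
  have e12 := e 1 2
  have e20 := e 2 0
  have e21 := e 2 1
  have e22 := e 2 2
  simp [Matrix.star_apply] at e00 e01 e02 e10 e11 e12 e20 e21 e22
  funext i
  rw [cross_apply, cross_apply]
  fin_cases i
  · simp [Matrix.mulVec, dotProduct, Fin.sum_univ_three]
    conv_lhs => rw [e00, e01, e02]
    ring
  · simp [Matrix.mulVec, dotProduct, Fin.sum_univ_three]
    conv_lhs => rw [e10, e11, e12]
    ring
  · simp [Matrix.mulVec, dotProduct, Fin.sum_univ_three]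
    conv_lhs => rw [e20, e21, e22]
    ring

theorem su_inner {A : Matrix (Fin 3) (Fin 3) ℂ} (hA : A ∈ Matrix.specialUnitaryGroup (Fin 3) ℂ)
    (u v : Fin 3 → ℂ) : (A.mulVec u) ⬝ᵥ star (A.mulVec v) = u ⬝ᵥ star v := by
  rw [Matrix.mem_specialUnitaryGroup_iff] at hA
  have h1 : A.conjTranspose * A = 1 := Matrix.mem_unitaryGroup_iff'.1 hA.1
  rw [Matrix.star_mulVec, dotProduct_comm, Matrix.dotProduct_mulVec, Matrix.vecMul_vecMul, h1,
    Matrix.vecMul_one, dotProduct_comm]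

/-- The linear map of `𝕆` given by a complex matrix. -/
def act (A : Matrix (Fin 3) (Fin 3) ℂ) : Octonion →ₗ[ℝ] Octonion where
  toFun x := mk (cz x) (A.mulVec (cv x))
  map_add' x y := by
    apply cext
    · simp only [cz_mk, cz_add]
    · simp only [cv_mk, cv_add, Matrix.mulVec_add]
  map_smul' r x := by
    apply cext
    · simp only [cz_mk, cz_smul, RingHom.id_apply]
    · simp only [cv_mk, cv_smul, Matrix.mulVec_smul, RingHom.id_apply]

theorem cz_act (A : Matrix (Fin 3) (Fin 3) ℂ) (x : Octonion) : cz (act A x) = cz x := rfl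
theorem cv_act (A : Matrix (Fin 3) (Fin 3) ℂ) (x : Octonion) :
    cv (act A x) = A.mulVec (cv x) := cv_mk _ _

theorem act_act (A B : Matrix (Fin 3) (Fin 3) ℂ) (x : Octonion) :
    act A (act B x) = act (A * B) x := by
  apply cext
  · simp only [cz_act]
  · simp only [cv_act, Matrix.mulVec_mulVec]

theorem act_one (x : Octonion) : act 1 x = x := by
  apply cext
  · simp only [cz_act]
  · simp only [cv_act, Matrix.one_mulVec]

/-- The linear automorphism of `𝕆` given by an element of `SU(3)`. -/
def actEquiv (A : Matrix.specialUnitaryGroup (Fin 3) ℂ) : Octonion ≃ₗ[ℝ] Octonion :=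
  LinearEquiv.ofLinearMap (act A.1) (act (A⁻¹).1)
    (by
      ext1 x
      show act A.1 (act (A⁻¹).1 x) = x
      rw [act_act, ← Submonoid.coe_mul, mul_inv_cancel]
      exact act_one x)
    (by
      ext1 x
      show act (A⁻¹).1 (act A.1 x) = x
      rw [act_act, ← Submonoid.coe_mul, inv_mul_cancel]
      exact act_one x)

theorem actEquiv_apply (A : Matrix.specialUnitaryGroup (Fin 3) ℂ) (x : Octonion) :
    actEquiv A x = act A.1 x := rfl

theorem actEquiv_mem (A : Matrix.specialUnitaryGroup (Fin 3) ℂ) : actEquiv A ∈ G2 := by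
  intro x y
  simp only [actEquiv_apply]
  apply cext
  · simp only [cz_mul, cz_act, cv_act, su_inner A.2]
  · simp only [cv_mul, cz_act, cv_act, Matrix.mulVec_add, Matrix.mulVec_smul, su_cross A.2]

theorem act_l0 (A : Matrix (Fin 3) (Fin 3) ℂ) : act A l0 = l0 := by
  apply cext
  · rw [cz_act]
  · rw [cv_act, l0, cv_mk, Matrix.mulVec_zero]

/-- The homomorphism from `SU(3)` to the isotropy group. -/
def suHom : Matrix.specialUnitaryGroup (Fin 3) ℂ →* isotropy l0 where
  toFun A := ⟨⟨actEquiv A, actEquiv_mem A⟩, act_l0 A.1⟩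
  map_one' := by
    apply Subtype.ext
    apply Subtype.ext
    ext1 x
    exact act_one x
  map_mul' A B := by
    apply Subtype.ext
    apply Subtype.ext
    ext1 x
    exact (act_act A.1 B.1 x).symm

theorem suHom_injective : Function.Injective suHom := by
  intro A B h
  apply Subtype.ext
  have h2 : ∀ x, act A.1 x = act B.1 x := fun x =>
    congrArg (fun g : isotropy l0 => (g.1.1 : Octonion ≃ₗ[ℝ] Octonion) x) h
  apply Matrix.mulVec_injective
  funext u
  have h3 := congrArg cv (h2 (mk 0 u))
  rwa [cv_act, cv_act, cv_mk] at h3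

theorem suHom_surjective : Function.Surjective suHom := by
  rintro ⟨⟨g, hg⟩, hl⟩
  replace hl : g l0 = l0 := hl
  have hone := G2_one hg
  have hscal : ∀ a : ℂ, g (mk a 0) = mk a 0 := by
    intro a
    have : mk a 0 = a.re • (1 : Octonion) + a.im • l0 := by
      rw [one_eq, l0]
      apply cext
      · rw [cz_add, cz_smul, cz_smul]; simp only [cz_mk]
        apply Complex.ext <;> simp
      · rw [cv_add, cv_smul, cv_smul]; simp only [cv_mk]
        simp
    rw [this, map_add, map_smul, map_smul, hone, hl]
  -- `g` preserves the complement of `ℂ`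
  have hcz : ∀ u, cz (g (mk 0 u)) = 0 := by
    intro u
    have h1 : l0 * mk 0 u + mk 0 u * l0 = 0 := by
      rw [l0, mk_mul, mk_mul, mk_add]
      apply cext
      · rw [cz_mk, cz_zero]; simp
      · rw [cv_mk, cv_zero]; simp
    have h2 := congrArg g h1
    rw [map_add, hg, hg, hl, map_zero] at h2
    have h3 := congrArg cz h2
    rw [cz_add, cz_mul, cz_mul, l0, cz_mk, cv_mk] at h3
    have h4 : cz 0 = 0 := rfl
    rw [h4] at h3
    simp at h3
    have h5 : 2 * Complex.I * cz (g (mk 0 u)) = 0 := by linear_combination h3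
    simpa using h5
  have hT : ∀ u, g (mk 0 u) = mk 0 (cv (g (mk 0 u))) := by
    intro u
    conv_lhs => rw [← mk_eta (g (mk 0 u)), hcz]
  -- the induced complex-linear map
  let T : (Fin 3 → ℂ) →ₗ[ℂ] (Fin 3 → ℂ) :=
    { toFun := fun u => cv (g (mk 0 u))
      map_add' := by
        intro u v
        rw [← cv_add, ← map_add, mk_add, add_zero]
      map_smul' := by
        intro a u
        have h : mk 0 (a • u) = mk a 0 * mk 0 u := by rw [mk_mul]; simp
        rw [h, hg, hscal, cv_mul, cz_mk, cv_mk, hcz]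
        simp }
  have hTg : ∀ u, g (mk 0 u) = mk 0 (T u) := hT
  have hprod : ∀ u v, T u ⬝ᵥ star (T v) = u ⬝ᵥ star v ∧
      star (crossProduct (T u) (T v)) = T (star (crossProduct u v)) := by
    intro u v
    have h1 := hg (mk 0 u) (mk 0 v)
    have h2 : mk 0 u * mk 0 v = mk (-(u ⬝ᵥ star v)) 0 + mk 0 (star (crossProduct u v)) := by
      rw [mk_mul, mk_add]; simp
    rw [h2, map_add, hscal, hTg, hTg, hTg, mk_mul, mk_add] at h1
    have h3 := congrArg cz h1
    have h4 := congrArg cv h1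
    simp [cz_mk] at h3
    simp [cv_mk] at h4
    exact ⟨h3.symm, h4.symm⟩
  let A := LinearMap.toMatrix' T
  have hA : ∀ u, A.mulVec u = T u := fun u => by
    rw [← Matrix.toLin'_apply, Matrix.toLin'_toMatrix']
  have hentry : ∀ i j, A i j = T (Pi.single j 1) i := fun i j => by
    rw [← hA]; simp
  have hAu : A ∈ Matrix.unitaryGroup (Fin 3) ℂ := by
    rw [Matrix.mem_unitaryGroup_iff']
    ext i j
    have h1 := (hprod (Pi.single j 1) (Pi.single i 1)).1
    rw [Matrix.mul_apply]
    simp only [dotProduct, Pi.star_apply] at h1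
    simp only [Matrix.star_apply, hentry]
    simp only [mul_comm (star _)]
    rw [h1]
    fin_cases i <;> fin_cases j <;> simp [Fin.sum_univ_three]
  have hAdet : A.det = 1 := by
    have h1 := (hprod (Pi.single 0 1) (Pi.single 1 1)).2
    have h2 : star (crossProduct (Pi.single 0 1 : Fin 3 → ℂ) (Pi.single 1 1)) = Pi.single 2 1 := by
      rw [cross_apply]
      funext i; fin_cases i <;> simp
    have h3 := (hprod (Pi.single 2 1) (Pi.single 2 1)).1
    rw [h2] at h1
    have h4 : star (T (Pi.single 2 1)) =
        crossProduct (T (Pi.single 0 1)) (T (Pi.single 1 1)) := by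
      rw [← h1, star_star]
    rw [h4, cross_apply] at h3
    simp [dotProduct, Fin.sum_univ_three] at h3
    rw [Matrix.det_fin_three]
    simp only [hentry]
    linear_combination h3
  refine ⟨⟨A, Matrix.mem_specialUnitaryGroup_iff.2 ⟨hAu, hAdet⟩⟩, ?_⟩
  apply Subtype.ext
  apply Subtype.ext
  ext1 x
  show act A x = g x
  have hx : x = mk (cz x) 0 + mk 0 (cv x) := by
    rw [mk_add, add_zero, zero_add, mk_eta]
  conv_rhs => rw [hx, map_add, hscal, hTg, mk_add, add_zero, zero_add, ← hA]
  rfl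

/-! ### Transitivity -/

/-- The octonion with given quaternion components. -/
def pair (a b : Quaternion ℝ) : Octonion := (a, b)
theorem pair_fst (a b : Quaternion ℝ) : (pair a b).1 = a := rfl
theorem pair_snd (a b : Quaternion ℝ) : (pair a b).2 = b := rfl

/-- The octonion with given real components. -/
def oct8 (a b c d e f g h : ℝ) : Octonion := pair ⟨a, b, c, d⟩ ⟨e, f, g, h⟩
theorem oct8_fst_re (a b c d e f g h : ℝ) : (oct8 a b c d e f g h).1.re = a := rfl
theorem oct8_fst_imI (a b c d e f g h : ℝ) : (oct8 a b c d e f g h).1.imI = b := rfl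
theorem oct8_fst_imJ (a b c d e f g h : ℝ) : (oct8 a b c d e f g h).1.imJ = c := rfl
theorem oct8_fst_imK (a b c d e f g h : ℝ) : (oct8 a b c d e f g h).1.imK = d := rfl
theorem oct8_snd_re (a b c d e f g h : ℝ) : (oct8 a b c d e f g h).2.re = e := rfl
theorem oct8_snd_imI (a b c d e f g h : ℝ) : (oct8 a b c d e f g h).2.imI = f := rfl
theorem oct8_snd_imJ (a b c d e f g h : ℝ) : (oct8 a b c d e f g h).2.imJ = g := rfl
theorem oct8_snd_imK (a b c d e f g h : ℝ) : (oct8 a b c d e f g h).2.imK = h := rfl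

/-- The linear map `(a, b) ↦ (q a q̄, q b p̄)`. -/
def pq (q p : Quaternion ℝ) : Octonion →ₗ[ℝ] Octonion where
  toFun x := pair (q * x.1 * star q) (q * x.2 * star p)
  map_add' x y := by
    apply Prod.ext
    · simp only [add_fst, pair_fst, mul_add, add_mul]
    · simp only [add_snd, pair_snd, mul_add, add_mul]
  map_smul' r x := by
    apply Prod.ext
    · simp only [smul_fst, pair_fst, mul_smul_comm, smul_mul_assoc, RingHom.id_apply]
    · simp only [smul_snd, pair_snd, mul_smul_comm, smul_mul_assoc, RingHom.id_apply]

theorem pq_apply (q p : Quaternion ℝ) (x : Octonion) :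
    pq q p x = (q * x.1 * star q, q * x.2 * star p) := rfl

theorem pq_inv {q p : Quaternion ℝ} (hq : star q * q = 1) (hp : star p * p = 1) (x : Octonion) :
    pq (star q) (star p) (pq q p x) = x := by
  rw [pq_apply, pq_apply]
  apply Prod.ext
  · show star q * (q * x.1 * star q) * star (star q) = x.1
    calc _ = (star q * q) * x.1 * (star q * q) := by rw [star_star]; noncomm_ring
      _ = x.1 := by rw [hq, one_mul, mul_one]
  · show star q * (q * x.2 * star p) * star (star p) = x.2
    calc _ = (star q * q) * x.2 * (star p * p) := by rw [star_star]; noncomm_ring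
      _ = x.2 := by rw [hq, hp, one_mul, mul_one]

theorem pq_mul {q p : Quaternion ℝ} (hq : star q * q = 1) (hp : star p * p = 1)
    (x y : Octonion) : pq q p (x * y) = pq q p x * pq q p y := by
  apply Prod.ext
  · rw [mul_fst, pq_apply, pq_apply, pq_apply]
    show q * (x.1 * y.1 - y.2 * star x.2) * star q =
      (q * x.1 * star q) * (q * y.1 * star q) - (q * y.2 * star p) * star (q * x.2 * star p)
    rw [star_mul, star_mul, star_star]
    calc _ = q * x.1 * 1 * (y.1 * star q) - q * y.2 * 1 * (star x.2 * star q) := by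
          noncomm_ring
      _ = q * x.1 * (star q * q) * (y.1 * star q)
          - q * y.2 * (star p * p) * (star x.2 * star q) := by rw [hq, hp]
      _ = _ := by simp only [mul_assoc]
  · rw [mul_snd, pq_apply, pq_apply, pq_apply]
    show q * (star x.1 * y.2 + y.1 * x.2) * star p =
      star (q * x.1 * star q) * (q * y.2 * star p) + (q * y.1 * star q) * (q * x.2 * star p)
    rw [star_mul, star_mul, star_star]
    calc _ = q * star x.1 * 1 * (y.2 * star p) + q * y.1 * 1 * (x.2 * star p) := by
          noncomm_ring
      _ = q * star x.1 * (star q * q) * (y.2 * star p)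
          + q * y.1 * (star q * q) * (x.2 * star p) := by rw [hq]
      _ = _ := by simp only [mul_assoc]

/-- A multiplicative linear map with an inverse gives an element of `G₂`. -/
theorem exists_G2 (f f' : Octonion →ₗ[ℝ] Octonion) (h : ∀ x, f (f' x) = x)
    (h' : ∀ x, f' (f x) = x) (hm : ∀ x y, f (x * y) = f x * f y) :
    ∃ g ∈ G2, ∀ x, g x = f x :=
  ⟨LinearEquiv.ofLinearMap f f' (LinearMap.ext h) (LinearMap.ext h'), hm, fun _ => rfl⟩

/-- A rotation fixing `j` and rotating `i` towards `l`. -/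
def rot (c s : ℝ) : Octonion →ₗ[ℝ] Octonion where
  toFun x := oct8 (x.1.re) (c * x.1.imI - s * x.2.re) (x.1.imJ) (c * x.1.imK - s * x.2.imJ) (s * x.1.imI + c * x.2.re) (x.2.imI) (s * x.1.imK + c * x.2.imJ) (x.2.imK)
  map_add' x y := by
    apply Prod.ext <;> apply Quaternion.ext <;> simp [add_fst, add_snd, oct8_fst_re, oct8_fst_imI, oct8_fst_imJ, oct8_fst_imK,
    oct8_snd_re, oct8_snd_imI, oct8_snd_imJ, oct8_snd_imK] <;> ring
  map_smul' r x := by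
    apply Prod.ext <;> apply Quaternion.ext <;> simp [smul_fst, smul_snd, oct8_fst_re, oct8_fst_imI, oct8_fst_imJ, oct8_fst_imK,
    oct8_snd_re, oct8_snd_imI, oct8_snd_imJ, oct8_snd_imK] <;> ring

theorem rot_fst_re (c s : ℝ) (x : Octonion) : (rot c s x).1.re = x.1.re := rfl
theorem rot_fst_imI (c s : ℝ) (x : Octonion) : (rot c s x).1.imI = c * x.1.imI - s * x.2.re := rfl
theorem rot_fst_imJ (c s : ℝ) (x : Octonion) : (rot c s x).1.imJ = x.1.imJ := rfl
theorem rot_fst_imK (c s : ℝ) (x : Octonion) : (rot c s x).1.imK = c * x.1.imK - s * x.2.imJ := rfl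
theorem rot_snd_re (c s : ℝ) (x : Octonion) : (rot c s x).2.re = s * x.1.imI + c * x.2.re := rfl
theorem rot_snd_imI (c s : ℝ) (x : Octonion) : (rot c s x).2.imI = x.2.imI := rfl
theorem rot_snd_imJ (c s : ℝ) (x : Octonion) : (rot c s x).2.imJ = s * x.1.imK + c * x.2.imJ := rfl
theorem rot_snd_imK (c s : ℝ) (x : Octonion) : (rot c s x).2.imK = x.2.imK := rfl

theorem rot_inv {c s : ℝ} (h : c ^ 2 + s ^ 2 = 1) (x : Octonion) :
    rot c (-s) (rot c s x) = x := by
  apply Prod.ext <;> apply Quaternion.ext <;> simp [rot_fst_re, rot_fst_imI, rot_fst_imJ, rot_fst_imK,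
    rot_snd_re, rot_snd_imI, rot_snd_imJ, rot_snd_imK]
  · linear_combination x.1.imI * h
  · linear_combination x.1.imK * h
  · linear_combination x.2.re * h
  · linear_combination x.2.imJ * h

theorem rot_mul {c s : ℝ} (h : c ^ 2 + s ^ 2 = 1) (x y : Octonion) :
    rot c s (x * y) = rot c s x * rot c s y := by
  apply Prod.ext <;> apply Quaternion.ext <;> simp [rot_fst_re, rot_fst_imI, rot_fst_imJ, rot_fst_imK,
    rot_snd_re, rot_snd_imI, rot_snd_imJ, rot_snd_imK, mul_fst, mul_snd]
  · linear_combination (x.1.imI * y.1.imI + x.1.imK * y.1.imK + x.2.re * y.2.re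
      + x.2.imJ * y.2.imJ) * h
  · ring
  · linear_combination (x.1.imI * y.1.imK - x.1.imK * y.1.imI
      + x.2.re * y.2.imJ - x.2.imJ * y.2.re) * h
  · ring
  · ring
  · linear_combination (x.1.imI * y.2.re - y.1.imI * x.2.re
      - x.1.imK * y.2.imJ + y.1.imK * x.2.imJ) * h
  · ring
  · linear_combination (x.1.imI * y.2.imJ - y.1.imI * x.2.imJ
      + x.1.imK * y.2.re - y.1.imK * x.2.re) * h

theorem unit_smul (w : Quaternion ℝ) (hw : w ≠ 0) :
    star (‖w‖⁻¹ • w) * (‖w‖⁻¹ • w) = 1 ∧ (‖w‖⁻¹ • w) * star (‖w‖⁻¹ • w) = 1 := by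
  have hn : ‖w‖ ≠ 0 := norm_ne_zero_iff.2 hw
  have e : ‖w‖⁻¹ * (‖w‖⁻¹ * (‖w‖ * ‖w‖)) = 1 := by field_simp
  constructor
  · rw [Quaternion.star_mul_self, Quaternion.normSq_eq_norm_mul_self, norm_smul, norm_inv,
      norm_norm, inv_mul_cancel₀ hn]; simp
  · rw [Quaternion.self_mul_star, Quaternion.normSq_eq_norm_mul_self, norm_smul, norm_inv,
      norm_norm, inv_mul_cancel₀ hn]; simp

theorem exists_p (b : Quaternion ℝ) : ∃ (p : Quaternion ℝ) (t : ℝ), star p * p = 1 ∧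
    p * star p = 1 ∧ b * star p = (t : Quaternion ℝ) := by
  by_cases hb : b = 0
  · exact ⟨1, 0, by simp, by simp, by simp [hb]⟩
  · refine ⟨‖b‖⁻¹ • b, ‖b‖⁻¹ * (‖b‖ * ‖b‖), (unit_smul b hb).1, (unit_smul b hb).2, ?_⟩
    rw [Quaternion.star_smul, mul_smul_comm, Quaternion.self_mul_star,
      Quaternion.normSq_eq_norm_mul_self, Quaternion.smul_coe]

/-- The quaternion `t i`. -/
def qi (t : ℝ) : Quaternion ℝ := ⟨0, t, 0, 0⟩
theorem qi_re (t : ℝ) : (qi t).re = 0 := rfl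
theorem qi_imI (t : ℝ) : (qi t).imI = t := rfl
theorem qi_imJ (t : ℝ) : (qi t).imJ = 0 := rfl
theorem qi_imK (t : ℝ) : (qi t).imK = 0 := rfl
theorem l0_fst_re : l0.1.re = 0 := rfl
theorem l0_fst_imI : l0.1.imI = 1 := rfl
theorem l0_fst_imJ : l0.1.imJ = 0 := rfl
theorem l0_fst_imK : l0.1.imK = 0 := rfl
theorem l0_snd_re : l0.2.re = 0 := rfl
theorem l0_snd_imI : l0.2.imI = 0 := by simp [l0, mk]
theorem l0_snd_imJ : l0.2.imJ = 0 := rfl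
theorem l0_snd_imK : l0.2.imK = 0 := by simp [l0, mk]

theorem exists_q (a : Quaternion ℝ) (ha : a.re = 0) : ∃ (q : Quaternion ℝ) (t : ℝ),
    star q * q = 1 ∧ q * star q = 1 ∧ q * a * star q = qi t := by
  let n : ℝ := √(a.imI ^ 2 + a.imJ ^ 2 + a.imK ^ 2)
  have hn : n ^ 2 = a.imI ^ 2 + a.imJ ^ 2 + a.imK ^ 2 := Real.sq_sqrt (by positivity)
  obtain ⟨w, w0, w1, w2, w3⟩ : ∃ w : Quaternion ℝ, w.re = n + a.imI ∧ w.imI = 0 ∧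
      w.imJ = a.imK ∧ w.imK = -a.imJ := ⟨⟨n + a.imI, 0, a.imK, -a.imJ⟩, rfl, rfl, rfl, rfl⟩
  by_cases hw : w = 0
  · have h2 : a.imK = 0 := by rw [← w2, hw]; rfl
    have h3 : -a.imJ = 0 := by rw [← w3, hw]; rfl
    refine ⟨1, a.imI, by simp, by simp, ?_⟩
    rw [one_mul, star_one, mul_one]
    apply Quaternion.ext
    · exact ha
    · rfl
    · exact neg_eq_zero.1 h3
    · exact h2
  · refine ⟨‖w‖⁻¹ • w, n, (unit_smul w hw).1, (unit_smul w hw).2, ?_⟩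
    have hc : w * a = qi n * w := by
      apply Quaternion.ext <;> simp [w0, w1, w2, w3, ha, qi_re, qi_imI, qi_imJ, qi_imK]
      · ring
      · linear_combination -hn
      · ring
      · ring
    rw [smul_mul_assoc, hc, ← mul_smul_comm, mul_assoc, (unit_smul w hw).2, mul_one]

theorem exists_from_l0 (u : Octonion) (hu : u ∈ S6) : ∃ g ∈ G2, g l0 = u := by
  have hre : u.1.re = 0 := hu.1
  obtain ⟨q, t, hq, hq', hqa⟩ := exists_q u.1 hre
  obtain ⟨p, s, hp, hp', hpb⟩ := exists_p (q * u.2)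
  obtain ⟨g, hg, hgx⟩ := exists_G2 (pq q p) (pq (star q) (star p))
    (fun x => by
      have := pq_inv (q := star q) (p := star p) (by rwa [star_star]) (by rwa [star_star]) x
      rwa [star_star, star_star] at this)
    (pq_inv hq hp) (pq_mul hq hp)
  have hgu : g u = pair (qi t) (s : Quaternion ℝ) := by
    rw [hgx, pq_apply, hqa, hpb]
    rfl
  have hts : t ^ 2 + s ^ 2 = 1 := by
    have h := (G2_S6 hg hu).2
    rw [hgu] at h
    have h' : (qi t * star (qi t) -
      (-(s : Quaternion ℝ)) * star (s : Quaternion ℝ)).re = 1 := h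
    simp [qi_re, qi_imI, qi_imJ, qi_imK] at h'
    linarith
  obtain ⟨r, hr, hrx⟩ := exists_G2 (rot t s) (rot t (-s))
    (fun x => by
      have := rot_inv (c := t) (s := -s) (by rwa [neg_sq]) x
      rwa [neg_neg] at this)
    (rot_inv hts) (rot_mul hts)
  have hrl : r l0 = g u := by
    rw [hrx, hgu]
    apply Prod.ext
    · rw [pair_fst]
      apply Quaternion.ext <;> simp [rot_fst_re, rot_fst_imI, rot_fst_imJ, rot_fst_imK,
    rot_snd_re, rot_snd_imI, rot_snd_imJ, rot_snd_imK,
        qi_re, qi_imI, qi_imJ, qi_imK, l0_fst_re, l0_fst_imI, l0_fst_imJ, l0_fst_imK, l0_snd_re, l0_snd_imI, l0_snd_imJ, l0_snd_imK]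
    · rw [pair_snd]
      apply Quaternion.ext <;> simp [rot_fst_re, rot_fst_imI, rot_fst_imJ, rot_fst_imK,
    rot_snd_re, rot_snd_imI, rot_snd_imJ, rot_snd_imK,
        qi_re, qi_imI, qi_imJ, qi_imK, l0_fst_re, l0_fst_imI, l0_fst_imJ, l0_fst_imK, l0_snd_re, l0_snd_imI, l0_snd_imJ, l0_snd_imK]
  refine ⟨g⁻¹ * r, G2.mul_mem (G2.inv_mem hg) hr, ?_⟩
  show g.symm (r l0) = u
  rw [hrl, g.symm_apply_apply]

theorem transitive (u : Octonion) (hu : u ∈ S6) (v : Octonion) (hv : v ∈ S6) :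
    ∃ g ∈ G2, g u = v := by
  obtain ⟨g, hg, hgu⟩ := exists_from_l0 u hu
  obtain ⟨h, hh, hhv⟩ := exists_from_l0 v hv
  refine ⟨h * g⁻¹, G2.mul_mem hh (G2.inv_mem hg), ?_⟩
  show h (g.symm u) = v
  rw [← hgu, g.symm_apply_apply, hhv]

/-- The action of `G₂` on `S⁶`. -/
abbrev actionS6 : MulAction G2 S6 where
  smul g x := ⟨g.1 x.1, G2_S6 g.2 x.2⟩
  one_smul _ := rfl
  mul_smul _ _ _ := rfl

attribute [local instance] actionS6

theorem stab_eq (l : S6) : MulAction.stabilizer G2 l = isotropy l.1 := by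
  ext g
  rw [MulAction.mem_stabilizer_iff]
  exact Subtype.ext_iff

theorem main (l : Octonion) (hl : l ∈ S6) :
    Nonempty (isotropy l ≃* Matrix.specialUnitaryGroup (Fin 3) ℂ) ∧
        Nonempty ((G2 ⧸ isotropy l) ≃ S6) := by
  constructor
  · obtain ⟨g, hg, hgl⟩ := exists_from_l0 l hl
    have e1 : MulAction.orbitRel G2 S6 ⟨l, hl⟩ ⟨l0, l0_mem⟩ :=
      ⟨⟨g, hg⟩, Subtype.ext hgl⟩
    have e2 := MulAction.stabilizerEquivStabilizerOfOrbitRel e1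
    rw [stab_eq, stab_eq] at e2
    exact ⟨e2.trans (MulEquiv.ofBijective suHom ⟨suHom_injective, suHom_surjective⟩).symm⟩
  · have e := MulAction.orbitEquivQuotientStabilizer G2 (⟨l, hl⟩ : S6)
    have ho : MulAction.orbit G2 (⟨l, hl⟩ : S6) = Set.univ := by
      ext v
      simp only [Set.mem_univ, iff_true]
      obtain ⟨g, hg, hgl⟩ := transitive l hl v.1 v.2
      exact ⟨⟨g, hg⟩, Subtype.ext hgl⟩
    rw [ho, stab_eq] at e
    exact ⟨e.symm.trans (Equiv.Set.univ _)⟩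

end Octonion

theorem statement15 :
    -- `G₂` acts transitively on `S⁶`
    (∀ u ∈ S6, ∀ v ∈ S6, ∃ g ∈ G2, g u = v) ∧
    -- the isotropy group of a point of `S⁶` is isomorphic to `SU(3)`,
    -- and hence `S⁶ ≅ G₂/SU(3)`
    ∀ l ∈ S6,
      Nonempty (isotropy l ≃* Matrix.specialUnitaryGroup (Fin 3) ℂ) ∧
        Nonempty ((G2 ⧸ isotropy l) ≃ S6) := by
  exact ⟨Octonion.transitive, Octonion.main⟩
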